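/- arXiv:1806.09263 — 2 statements merged into one kernel-verified Lean document; each statement's English description precedes it below -/
import Mathlib

section
/- For every integer n ≥ 3, the algebra E_n^! is not a prime ring: there exist nonzero elements u, v ∈ E_n^! such that u r v = 0 for every r ∈ E_n^!. (Indeed, one may take u = y_{2,3} and v = y_{1,2}^2 − y_{1,3}^2, which are both nonzero and satisfy y_{2,3} (y_{1,2}^2 − y_{1,3}^2) = 0 together with the centrality of y_{1,2}^2 and y_{1,3}^2.) -/
/- The quadratic dual Fomin–Kirillov algebra `E_n^!` over an algebraically
closed field `k` of characteristic zero, presented as a quotient of the free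
algebra on generators `y_{i,j}` (for `1 ≤ i < j ≤ n`, realized here with
`0`-based indexing by the subtype of pairs `(i,j) : Fin n × Fin n` with `i < j`),
with the convention `y_{j,i} = -y_{i,j}`. -/

noncomputable section

variable (k : Type) [Field k] [IsAlgClosed k] [CharZero k]

/-- Index set for the generators: pairs `(i,j)` with `i < j`. -/
abbrev FKIdx (n : ℕ) := {p : Fin n × Fin n // p.1 < p.2}

/-- The element `y_{i,j}` of the free algebra, with the convention
`y_{j,i} = -y_{i,j}` (and `y_{i,i} = 0`, which is never used). -/
def Ygen (n : ℕ) (i j : Fin n) : FreeAlgebra k (FKIdx n) :=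
  if h : i < j then FreeAlgebra.ι k ⟨(i, j), h⟩
  else if h' : j < i then - FreeAlgebra.ι k ⟨(j, i), h'⟩
  else 0

/-- The defining relations of `E_n^!`. -/
inductive FKRel (n : ℕ) : FreeAlgebra k (FKIdx n) → FreeAlgebra k (FKIdx n) → Prop
  | triple (i j l : Fin n) (hij : i ≠ j) (hjl : j ≠ l) (hil : i ≠ l) :
      FKRel n (Ygen k n i j * Ygen k n j l + Ygen k n j l * Ygen k n i l) 0
  | disj (i j s t : Fin n) (hij : i < j) (hst : s < t)
      (h1 : i ≠ s) (h2 : i ≠ t) (h3 : j ≠ s) (h4 : j ≠ t) :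
      FKRel n (Ygen k n i j * Ygen k n s t + Ygen k n s t * Ygen k n i j) 0

/-- The quadratic dual Fomin–Kirillov algebra `E_n^!`. -/
abbrev FKDual (n : ℕ) := RingQuot (FKRel k n)

/-- The generator `y_{i,j}` of `E_n^!`. -/
def yy (n : ℕ) (i j : Fin n) : FKDual k n :=
  RingQuot.mkAlgHom k (FKRel k n) (Ygen k n i j)

section helpers

theorem fkaux_adj {A : Type} [Ring A] {a b c a' b' c' : A} (ha : a' + a = 0) (hb : b' + b = 0)
    (hc : c' + c = 0) (h1 : c' * a + a * b' = 0) (h2 : b' * a' + a' * c' = 0) :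
    a ^ 2 * b = b * a ^ 2 := by
  obtain rfl := eq_neg_of_add_eq_zero_left ha
  obtain rfl := eq_neg_of_add_eq_zero_left hb
  obtain rfl := eq_neg_of_add_eq_zero_left hc
  simp only [neg_mul, mul_neg, neg_neg] at h1 h2
  have h1' : a * b = -(c * a) := by
    rw [← neg_add, neg_eq_zero] at h1
    exact eq_neg_of_add_eq_zero_right h1
  have h2' : a * c = -(b * a) := eq_neg_of_add_eq_zero_right h2
  rw [pow_two, mul_assoc, h1', mul_neg, ← mul_assoc, h2', neg_mul, neg_neg, mul_assoc]

theorem fkaux_anti {A : Type} [Ring A] {a b c : A} (h : a * b + b * c = 0) :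
    a ^ 2 * b = b * c ^ 2 := by
  have h' := eq_neg_of_add_eq_zero_left h
  rw [pow_two, mul_assoc, h', mul_neg, ← mul_assoc, h', neg_mul, neg_neg, mul_assoc, pow_two]

theorem fkaux_sq {A : Type} [Ring A] {a a' : A} (h : a' + a = 0) : a' ^ 2 = a ^ 2 := by
  rw [eq_neg_of_add_eq_zero_left h, neg_sq]

theorem fkaux_comm {A : Type} [Ring A] {a a' b : A} (h : a' + a = 0) (hb : b * a' = a' * b) :
    b * a = a * b := by
  rw [eq_neg_of_add_eq_zero_right h, mul_neg, neg_mul, hb]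

theorem fkaux_sub {A : Type} [Ring A] {u a b : A} (h : u * a = u * b) : u * (a - b) = 0 := by
  rw [mul_sub, h, sub_self]

theorem fkaux_final {A : Type} [Ring A] {u a b r : A} (h : u * (a - b) = 0)
    (ha : a * r = r * a) (hb : b * r = r * b) : u * r * (a - b) = 0 := by
  have : r * (a - b) = (a - b) * r := by rw [mul_sub, sub_mul, ha, hb]
  rw [mul_assoc, this, ← mul_assoc, h, zero_mul]

theorem yy_neg (n : ℕ) (i j : Fin n) : yy k n j i + yy k n i j = 0 := by
  unfold yy
  rw [← map_add]
  have : Ygen k n j i + Ygen k n i j = 0 := by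
    unfold Ygen
    rcases lt_trichotomy i j with h | h | h
    · simp [h, h.not_gt]
    · subst h; simp
    · simp [h, h.not_gt]
  rw [this, map_zero]

theorem yy_triple (n : ℕ) (i j l : Fin n) (hij : i ≠ j) (hjl : j ≠ l) (hil : i ≠ l) :
    yy k n i j * yy k n j l + yy k n j l * yy k n i l = 0 := by
  have h := RingQuot.mkAlgHom_rel k (FKRel.triple (k := k) i j l hij hjl hil)
  rw [map_add, map_mul, map_mul, map_zero] at h
  exact h

theorem yy_disj (n : ℕ) (i j s t : Fin n) (hij : i < j) (hst : s < t)
    (h1 : i ≠ s) (h2 : i ≠ t) (h3 : j ≠ s) (h4 : j ≠ t) :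
    yy k n i j * yy k n s t + yy k n s t * yy k n i j = 0 := by
  have h := RingQuot.mkAlgHom_rel k (FKRel.disj (k := k) i j s t hij hst h1 h2 h3 h4)
  rw [map_add, map_mul, map_mul, map_zero] at h
  exact h

/-- `y_{ij}^2` commutes with `y_{jl}`. -/
theorem sq_comm_adj (n : ℕ) (i j l : Fin n) (hij : i ≠ j) (hjl : j ≠ l) (hil : i ≠ l) :
    Commute (yy k n i j ^ 2) (yy k n j l) := by
  have h1 := yy_triple k n l i j hil.symm hij hjl.symm
  have h2 := yy_triple k n l j i hjl.symm hij.symm hil.symm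
  exact fkaux_adj (yy_neg k n i j) (yy_neg k n j l) (yy_neg k n i l) h1 h2

theorem yy_sq_symm (n : ℕ) (i j : Fin n) : yy k n j i ^ 2 = yy k n i j ^ 2 :=
  fkaux_sq (yy_neg k n i j)

theorem sq_comm_gen (n : ℕ) (i j s t : Fin n) (hij : i < j) (hst : s < t) :
    Commute (yy k n i j ^ 2) (yy k n s t) := by
  by_cases h1 : j = s
  · subst h1
    exact sq_comm_adj k n i j t hij.ne hst.ne (hij.trans hst).ne
  by_cases h2 : i = t
  · subst h2
    rw [← yy_sq_symm]
    exact fkaux_comm (yy_neg k n s i)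
      (sq_comm_adj k n j i s hij.ne' hst.ne' (hst.trans hij).ne').eq
  by_cases h3 : i = s
  · subst h3
    by_cases h4 : j = t
    · subst h4
      exact (Commute.refl _).pow_left 2
    · rw [← yy_sq_symm]
      exact sq_comm_adj k n j i t hij.ne' hst.ne h4
  by_cases h4 : j = t
  · subst h4
    exact fkaux_comm (yy_neg k n s j) (sq_comm_adj k n i j s hij.ne hst.ne' h3).eq
  exact fkaux_anti (yy_disj k n i j s t hij hst h3 h2 h1 h4)

theorem sq_central (n : ℕ) (i j : Fin n) (hij : i < j) (r : FKDual k n) :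
    Commute (yy k n i j ^ 2) r := by
  obtain ⟨x, rfl⟩ := RingQuot.mkAlgHom_surjective k (FKRel k n) r
  induction x using FreeAlgebra.induction with
  | grade0 c => rw [AlgHom.commutes]; exact (Algebra.commutes c _).symm
  | grade1 p =>
    obtain ⟨⟨s, t⟩, hst⟩ := p
    have h := sq_comm_gen k n i j s t hij hst
    have e : yy k n s t = RingQuot.mkAlgHom k (FKRel k n) (FreeAlgebra.ι k ⟨(s, t), hst⟩) := by
      unfold yy Ygen
      rw [dif_pos hst]
    rwa [e] at h
  | mul a b ha hb => rw [map_mul]; exact ha.mul_right hb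
  | add a b ha hb => rw [map_add]; exact ha.add_right hb

/-- The character of the free algebra sending one generator to `1`, the others to `0`. -/
def chi0 (n : ℕ) (p : FKIdx n) : FreeAlgebra k (FKIdx n) →ₐ[k] k :=
  FreeAlgebra.lift k (fun q => if q = p then 1 else 0)

theorem chi0_Ygen (n : ℕ) (p : FKIdx n) (i j : Fin n)
    (h1 : ¬ (i = p.1.1 ∧ j = p.1.2)) (h2 : ¬ (j = p.1.1 ∧ i = p.1.2)) :
    chi0 k n p (Ygen k n i j) = 0 := by
  obtain ⟨⟨s, t⟩, hst⟩ := p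
  unfold chi0 Ygen
  split_ifs <;> simp_all

theorem chi0_mul (n : ℕ) (p : FKIdx n) (i j s t : Fin n)
    (h : ¬ (i = s ∧ j = t)) (h' : ¬ (i = t ∧ j = s)) :
    chi0 k n p (Ygen k n i j * Ygen k n s t) = 0 := by
  rw [map_mul]
  by_cases h1 : (i = p.1.1 ∧ j = p.1.2) ∨ (j = p.1.1 ∧ i = p.1.2)
  · rw [chi0_Ygen k n p s t, mul_zero] <;> grind
  · rw [chi0_Ygen k n p i j, zero_mul] <;> grind

/-- The induced character of `E_n^!`. -/
def chi (n : ℕ) (p : FKIdx n) : FKDual k n →ₐ[k] k :=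
  RingQuot.liftAlgHom k ⟨chi0 k n p, by
    intro x y h
    cases h with
    | triple i j l hij hjl hil =>
      rw [map_add, chi0_mul, chi0_mul, map_zero, add_zero] <;> grind
    | disj i j s t hij hst h1 h2 h3 h4 =>
      rw [map_add, chi0_mul, chi0_mul, map_zero, add_zero] <;> grind⟩

theorem chi_yy (n : ℕ) (p : FKIdx n) (i j : Fin n) (hij : i < j) :
    chi k n p (yy k n i j) = if (⟨(i, j), hij⟩ : FKIdx n) = p then 1 else 0 := by
  unfold chi yy
  rw [RingQuot.liftAlgHom_mkAlgHom_apply]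
  unfold chi0 Ygen
  rw [dif_pos hij, FreeAlgebra.lift_ι_apply]

theorem sq_mul_eq (n : ℕ) (i j l : Fin n) (hij : i < j) (hjl : j < l) :
    yy k n j l * (yy k n i j ^ 2 - yy k n i l ^ 2) = 0 := by
  have h := yy_triple k n i j l hij.ne hjl.ne (hij.trans hjl).ne
  have hc := sq_central k n i j hij (yy k n j l)
  exact fkaux_sub (hc.eq.symm.trans (fkaux_anti h))

end helpers

/-- For every `n ≥ 3`, the algebra `E_n^!` is not a prime ring:
there exist nonzero elements `u, v` with `u * r * v = 0` for all `r`.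
Indeed one may take `u = y_{2,3}` and `v = y_{1,2}^2 - y_{1,3}^2`
(here in `0`-based indexing: `u = y 1 2`, `v = (y 0 1)^2 - (y 0 2)^2`). -/
theorem FKDual_not_prime (n : ℕ) (hn : 3 ≤ n) :
    ∃ u v : FKDual k n, u ≠ 0 ∧ v ≠ 0 ∧ (∀ r : FKDual k n, u * r * v = 0) ∧
      u = yy k n ⟨1, by omega⟩ ⟨2, by omega⟩ ∧
      v = (yy k n ⟨0, by omega⟩ ⟨1, by omega⟩) ^ 2
          - (yy k n ⟨0, by omega⟩ ⟨2, by omega⟩) ^ 2 := by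
  have h01 : (⟨0, by omega⟩ : Fin n) < ⟨1, by omega⟩ := by simp
  have h12 : (⟨1, by omega⟩ : Fin n) < ⟨2, by omega⟩ := by simp
  have h02 : (⟨0, by omega⟩ : Fin n) < ⟨2, by omega⟩ := by simp
  refine ⟨_, _, ?_, ?_, ?_, rfl, rfl⟩
  · intro h
    have := congrArg (chi k n ⟨(_, _), h12⟩) h
    rw [chi_yy k n _ _ _ h12] at this
    simp at this
  · intro h
    have := congrArg (chi k n ⟨(_, _), h01⟩) h
    rw [map_sub, map_pow, map_pow, chi_yy k n _ _ _ h01, chi_yy k n _ _ _ h02] at this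
    simp at this
  · intro r
    exact fkaux_final (sq_mul_eq k n _ _ _ h01 h12) (sq_central k n _ _ h01 r).eq
      (sq_central k n _ _ h02 r).eq

end
end

section
/- The algebra D_n is reduced: it has no nonzero nilpotent elements. Consequently, D_n is semiprime. -/
/- The commutative algebra `D_n` over an algebraically closed field `k` of
characteristic zero: generated by `a_{i,j}` for `1 ≤ i < j ≤ n` (with the
convention `a_{j,i} = a_{i,j}`), subject to `a_{i,j} a_{j,l} = a_{i,j} a_{i,l}`
for pairwise distinct `i, j, l`; realized as a quotient of a polynomial ring. -/

noncomputable section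

variable (k : Type) [Field k] [IsAlgClosed k] [CharZero k]

/-- Index set for the generators: pairs `(i,j)` with `i < j`. -/
abbrev DIdx (n : ℕ) := {p : Fin n × Fin n // p.1 < p.2}

/-- The generator `a_{i,j}` of the polynomial ring, with the convention
`a_{j,i} = a_{i,j}` (and `a_{i,i} = 0`, never used). -/
def Agen (n : ℕ) (i j : Fin n) : MvPolynomial (DIdx n) k :=
  if h : i < j then MvPolynomial.X ⟨(i, j), h⟩
  else if h' : j < i then MvPolynomial.X ⟨(j, i), h'⟩
  else 0

/-- The defining relations of `D_n`. -/
def DRelSet (n : ℕ) : Set (MvPolynomial (DIdx n) k) :=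
  {p | ∃ i j l : Fin n, i ≠ j ∧ j ≠ l ∧ i ≠ l ∧
    p = Agen k n i j * Agen k n j l - Agen k n i j * Agen k n i l}

/-- The commutative algebra `D_n`. -/
abbrev DAlg (n : ℕ) := MvPolynomial (DIdx n) k ⧸ Ideal.span (DRelSet k n)

/-- The generator `a_{i,j}` of `D_n`. -/
def aa (n : ℕ) (i j : Fin n) : DAlg k n :=
  Ideal.Quotient.mk (Ideal.span (DRelSet k n)) (Agen k n i j)

/-- The setoid on vertices generated by the edges of a monomial. -/
def conn (n : ℕ) (m : DIdx n →₀ ℕ) : Setoid (Fin n) :=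
  sInf {s | ∀ e : DIdx n, m e ≠ 0 → s e.1.1 e.1.2}

theorem conn_le {n : ℕ} {m : DIdx n →₀ ℕ} {s : Setoid (Fin n)}
    (h : ∀ e : DIdx n, m e ≠ 0 → s e.1.1 e.1.2) : conn n m ≤ s := sInf_le h

theorem conn_edge {n : ℕ} {m : DIdx n →₀ ℕ} (e : DIdx n) (h : m e ≠ 0) :
    conn n m e.1.1 e.1.2 := by
  intro s hs
  exact hs e h

theorem conn_le_iff {n : ℕ} {m : DIdx n →₀ ℕ} {s : Setoid (Fin n)} :
    conn n m ≤ s ↔ ∀ e : DIdx n, m e ≠ 0 → s e.1.1 e.1.2 :=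
  ⟨fun h e he => h (conn_edge e he), conn_le⟩

theorem aa_symm (n : ℕ) (i j : Fin n) : aa k n i j = aa k n j i := by
  unfold aa Agen
  rcases lt_trichotomy i j with h | h | h
  · simp [h, h.not_gt]
  · simp [h]
  · simp [h, h.not_gt]

theorem aa_rel (n : ℕ) (i j l : Fin n) (h1 : i ≠ j) (h2 : j ≠ l) (h3 : i ≠ l) :
    aa k n i j * aa k n j l = aa k n i j * aa k n i l := by
  unfold aa
  rw [← map_mul, ← map_mul]
  exact Ideal.Quotient.eq.2 (Ideal.subset_span ⟨i, j, l, h1, h2, h3, rfl⟩)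

/-- Image of a monomial in `D_n`. -/
def mon (n : ℕ) (m : DIdx n →₀ ℕ) : DAlg k n :=
  Ideal.Quotient.mk (Ideal.span (DRelSet k n)) (MvPolynomial.monomial m 1)

theorem mon_add_single (n : ℕ) (m : DIdx n →₀ ℕ) (e : DIdx n) :
    mon k n (m + Finsupp.single e 1) = mon k n m * aa k n e.1.1 e.1.2 := by
  unfold mon aa Agen
  rw [← map_mul, dif_pos e.2]
  congr 1
  rw [MvPolynomial.X, MvPolynomial.monomial_mul, one_mul]

theorem mon_dvd (n : ℕ) (m : DIdx n →₀ ℕ) (e : DIdx n) (he : m e ≠ 0) :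
    ∃ Q, mon k n m = Q * aa k n e.1.1 e.1.2 := by
  refine ⟨mon k n (m - Finsupp.single e 1), ?_⟩
  rw [← mon_add_single, tsub_add_cancel_of_le]
  rw [Finsupp.single_le_iff]
  omega

/-- symmetric edge predicate -/
def isEdge (n : ℕ) (m : DIdx n →₀ ℕ) (i j : Fin n) : Prop :=
  ∃ e : DIdx n, m e ≠ 0 ∧ ((e.1.1 = i ∧ e.1.2 = j) ∨ (e.1.1 = j ∧ e.1.2 = i))

theorem isEdge_dvd (n : ℕ) (m : DIdx n →₀ ℕ) (i j : Fin n) (h : isEdge n m i j) :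
    ∃ Q, mon k n m = Q * aa k n i j := by
  obtain ⟨e, he, ⟨rfl, rfl⟩ | ⟨rfl, rfl⟩⟩ := h
  · exact mon_dvd k n m e he
  · rw [aa_symm]; exact mon_dvd k n m e he

theorem isEdge_ne {n : ℕ} {m : DIdx n →₀ ℕ} {i j : Fin n} (h : isEdge n m i j) : i ≠ j := by
  obtain ⟨e, he, ⟨rfl, rfl⟩ | ⟨rfl, rfl⟩⟩ := h
  · exact e.2.ne
  · exact e.2.ne'

theorem move_edge (n : ℕ) (m : DIdx n →₀ ℕ) (i j l : Fin n) (hij : i ≠ j) (hil : i ≠ l)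
    (h : isEdge n m j l) :
    mon k n m * aa k n i j = mon k n m * aa k n i l := by
  obtain ⟨Q, hQ⟩ := isEdge_dvd k n m j l h
  have hjl := isEdge_ne h
  have h1 := aa_rel k n j l i hjl hil.symm hij.symm
  rw [aa_symm k n l i, aa_symm k n j i] at h1
  rw [hQ, mul_assoc, mul_assoc, h1]

theorem move_conn (n : ℕ) (m : DIdx n →₀ ℕ) (i j l : Fin n) (hij : i ≠ j) (hil : i ≠ l)
    (h : conn n m j l) :
    mon k n m * aa k n i j = mon k n m * aa k n i l := by
  classical
  obtain ⟨c, hc⟩ : ∃ c : DAlg k n, ∀ q, isEdge n m i q → mon k n m * aa k n i q = c := by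
    by_cases hq : ∃ q, isEdge n m i q
    · obtain ⟨q, hq⟩ := hq
      refine ⟨mon k n m * aa k n i q, fun q' hq' => ?_⟩
      by_cases hqq : q' = q
      · rw [hqq]
      have e1 := move_edge k n m q' i q (isEdge_ne hq').symm hqq hq
      have e2 := move_edge k n m q i q' (isEdge_ne hq).symm (Ne.symm hqq) hq'
      rw [aa_symm k n i q', e1, aa_symm k n q' q, ← e2, aa_symm k n q i]
    · exact ⟨0, fun q h => (hq ⟨q, h⟩).elim⟩
  let f : Fin n → DAlg k n := fun x => if x = i then c else mon k n m * aa k n i x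
  have key : conn n m ≤ Setoid.ker f := by
    refine conn_le fun e he => ?_
    have hed : isEdge n m e.1.1 e.1.2 := ⟨e, he, Or.inl ⟨rfl, rfl⟩⟩
    have hed' : isEdge n m e.1.2 e.1.1 := ⟨e, he, Or.inr ⟨rfl, rfl⟩⟩
    rw [Setoid.ker_def]
    have hne := e.2.ne
    simp only [f]
    split_ifs with h1 h2 h2
    · rfl
    · rw [h1] at hed; exact (hc _ hed).symm
    · rw [h2] at hed'; exact hc _ hed'
    · exact move_edge k n m i _ _ (Ne.symm h1) (Ne.symm h2) hed
  have := key h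
  rw [Setoid.ker_def] at this
  simpa only [f, if_neg hij.symm, if_neg hil.symm] using this

theorem move_cross (n : ℕ) (m : DIdx n →₀ ℕ) (i j x y : Fin n) (hij : i ≠ j) (hxy : x ≠ y)
    (hxj : x ≠ j) (h1 : conn n m i x) (h2 : conn n m j y) :
    mon k n m * aa k n i j = mon k n m * aa k n x y := by
  rw [aa_symm k n i j, move_conn k n m j i x hij.symm hxj.symm h1, aa_symm k n j x,
    move_conn k n m x j y hxj hxy h2]

theorem move_in (n : ℕ) (m : DIdx n →₀ ℕ) (i j x y : Fin n) (hij : i ≠ j) (hxy : x ≠ y)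
    (h0 : conn n m i j) (h1 : conn n m i x) (h2 : conn n m x y) :
    mon k n m * aa k n i j = mon k n m * aa k n x y := by
  have h1' := (conn n m).symm h1
  by_cases hxj : x = j
  · subst hxj
    rw [aa_symm k n i x]
    exact move_conn k n m x i y hij.symm hxy ((conn n m).trans h1 h2)
  · exact move_cross k n m i j x y hij hxy hxj h1
      ((conn n m).trans ((conn n m).symm h0) ((conn n m).trans h1 h2))

/-- Joining two classes of a setoid. -/
theorem conn_add_single {n : ℕ} (m : DIdx n →₀ ℕ) (e : DIdx n) (x y : Fin n)
    (h : conn n (m + Finsupp.single e 1) x y) :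
    conn n m x y ∨ (conn n m e.1.1 x ∧ conn n m e.1.2 y) ∨
      (conn n m e.1.2 x ∧ conn n m e.1.1 y) := by
  classical
  set r := conn n m with hr
  let f : Fin n → Quotient r := fun z => if r e.1.2 z then Quotient.mk r e.1.1 else Quotient.mk r z
  have key : conn n (m + Finsupp.single e 1) ≤ Setoid.ker f := by
    refine conn_le fun e' he' => ?_
    rw [Setoid.ker_def]
    by_cases hm : m e' = 0
    · have : e = e' := by
        by_contra hne
        apply he'
        simp [hm, Finsupp.single_apply, hne]
      subst this
      simp only [f, if_pos (r.refl e.1.2)]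
      split_ifs <;> rfl
    · have h1 : r e'.1.1 e'.1.2 := conn_edge e' hm
      simp only [f]
      split_ifs with h2 h3 h3
      · rfl
      · exact (h3 (r.trans h2 h1)).elim
      · exact (h2 (r.trans h3 (r.symm h1))).elim
      · exact Quotient.sound h1
  have h2 := key h
  rw [Setoid.ker_def] at h2
  simp only [f] at h2
  split_ifs at h2 with h3 h4 h4
  · exact Or.inl (r.trans (r.symm h3) h4)
  · exact Or.inr (Or.inr ⟨h3, Quotient.exact h2⟩)
  · exact Or.inr (Or.inl ⟨r.symm (Quotient.exact h2), h4⟩)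
  · exact Or.inl (Quotient.exact h2)

theorem conn_mono {n : ℕ} {m m' : DIdx n →₀ ℕ} (h : m ≤ m') : conn n m ≤ conn n m' :=
  conn_le fun e he => conn_edge e fun h0 => he (by have := h e; omega)

/-- The block of an edge. -/
def blk {n : ℕ} (s : Setoid (Fin n)) (e : DIdx n) : Quotient s := Quotient.mk s e.1.1

theorem mapDomain_eval {α β : Type} [Fintype α] [DecidableEq β] (f : α → β) (m : α →₀ ℕ) (b : β) :
    Finsupp.mapDomain f m b = ∑ e, if f e = b then m e else 0 := by
  rw [Finsupp.mapDomain, Finsupp.sum_apply, Finsupp.sum_fintype _ _ (by simp)]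
  simp [Finsupp.single_apply]

theorem mon_eq_aux (n : ℕ) (s : Setoid (Fin n)) (m' : DIdx n →₀ ℕ) (hm' : conn n m' = s) (N : ℕ) :
    ∀ m : DIdx n →₀ ℕ, ∑ e, (m e - m' e) = N → conn n m = s →
      Finsupp.mapDomain (blk s) m = Finsupp.mapDomain (blk s) m' →
      mon k n m = mon k n m' := by
  classical
  induction N using Nat.strong_induction_on with
  | _ N ih =>
  intro m hN hm hd
  have hdeg : ∀ b, (∑ e, if blk s e = b then m e else 0) = ∑ e, if blk s e = b then m' e else 0 := by
    intro b
    rw [← mapDomain_eval, ← mapDomain_eval, hd]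
  -- a pigeonhole principle within a block
  have pig : ∀ e, m' e < m e → ∃ e', blk s e' = blk s e ∧ m e' < m' e' := by
    intro e he
    by_contra hcon
    push Not at hcon
    have := hdeg (blk s e)
    refine absurd this (ne_of_gt (Finset.sum_lt_sum (fun e' _ => ?_) ⟨e, Finset.mem_univ _, ?_⟩))
    · split_ifs with h
      · exact hcon e' h
      · exact le_rfl
    · simpa using he
  by_cases hex : ∃ e, m' e < m e
  swap
  · push Not at hex
    have : m = m' := by
      ext e
      refine le_antisymm (hex e) ?_
      by_contra hlt
      push Not at hlt
      have := hdeg (blk s e)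
      refine absurd this (ne_of_lt (Finset.sum_lt_sum (fun e' _ => ?_) ⟨e, Finset.mem_univ _, ?_⟩))
      · split_ifs with h
        · exact hex e'
        · exact le_rfl
      · simpa using hlt
    rw [this]
  obtain ⟨e, he⟩ := hex
  obtain ⟨m0, rfl⟩ : ∃ m0, m = m0 + Finsupp.single e 1 := by
    refine ⟨m - Finsupp.single e 1, (tsub_add_cancel_of_le ?_).symm⟩
    rw [Finsupp.single_le_iff]
    omega
  have hle : conn n m0 ≤ s := hm ▸ conn_mono (le_self_add)
  have hes : s e.1.1 e.1.2 := hm ▸ conn_edge e (by simp)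
  -- the exchange
  suffices hx : ∃ e', blk s e' = blk s e ∧ (m0 + Finsupp.single e 1 : DIdx n →₀ ℕ) e' < m' e' ∧
      conn n (m0 + Finsupp.single e' 1) = s ∧
      mon k n m0 * aa k n e.1.1 e.1.2 = mon k n m0 * aa k n e'.1.1 e'.1.2 by
    obtain ⟨e', hb, hlt, hc, hmon⟩ := hx
    have hne : e ≠ e' := by
      rintro rfl
      omega
    rw [mon_add_single, hmon, ← mon_add_single]
    refine ih _ ?_ (m0 + Finsupp.single e' 1) rfl hc ?_
    · rw [← hN]
      refine Finset.sum_lt_sum (fun f _ => ?_) ⟨e, Finset.mem_univ _, ?_⟩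
      · by_cases hf : f = e'
        · subst hf
          simp [Finsupp.single_apply, hne] at hlt ⊢
          omega
        · simp [Finsupp.single_apply, Ne.symm hf]
          omega
      · simp [Finsupp.single_apply, hne.symm] at he ⊢
        omega
    · rw [← hd, Finsupp.mapDomain_add, Finsupp.mapDomain_add, Finsupp.mapDomain_single,
        Finsupp.mapDomain_single, hb]
  by_cases hcase : conn n m0 = s
  · obtain ⟨e', hb, hlt⟩ := pig e he
    have he's : s e'.1.1 e'.1.2 := hm' ▸ conn_edge e' (by omega)
    refine ⟨e', hb, hlt, ?_, ?_⟩
    · apply le_antisymm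
      · refine conn_le fun f hf => ?_
        by_cases hfe : e' = f
        · exact hfe ▸ he's
        · refine hle (conn_edge f ?_)
          simpa [Finsupp.single_apply, hfe] using hf
      · rw [← hcase]
        exact conn_mono le_self_add
    · refine move_in k n m0 _ _ _ _ e.2.ne e'.2.ne ?_ ?_ ?_
      · rw [hcase]; exact hes
      · rw [hcase]; exact s.symm (Quotient.exact hb)
      · rw [hcase]; exact he's
  · obtain ⟨e', he'm, he'n⟩ : ∃ e', m' e' ≠ 0 ∧ ¬ conn n m0 e'.1.1 e'.1.2 := by
      by_contra hcon
      push Not at hcon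
      exact hcase (le_antisymm hle (hm' ▸ conn_le hcon))
    have hm0 : m0 e' = 0 := by
      by_contra h
      exact he'n (conn_edge e' h)
    have hne : e ≠ e' := by
      rintro rfl
      simp [hm0] at he
      omega
    have he's : s e'.1.1 e'.1.2 := hm' ▸ conn_edge e' he'm
    have hle' : conn n (m0 + Finsupp.single e' 1) ≤ s := by
      refine conn_le fun f hf => ?_
      by_cases hfe : e' = f
      · exact hfe ▸ he's
      · refine hle (conn_edge f ?_)
        simpa [Finsupp.single_apply, hfe] using hf
    have hlt : (m0 + Finsupp.single e 1 : DIdx n →₀ ℕ) e' < m' e' := by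
      simp [Finsupp.single_apply, hne, hm0]
      omega
    have hge : conn n (m0 + Finsupp.single e' 1) e.1.1 e.1.2 →
        s ≤ conn n (m0 + Finsupp.single e' 1) := by
      intro h
      rw [← hm]
      refine conn_le fun f hf => ?_
      by_cases hfe : e = f
      · exact hfe ▸ h
      · refine conn_mono le_self_add (conn_edge (m := m0) f ?_)
        simpa [Finsupp.single_apply, hfe] using hf
    set t := conn n (m0 + Finsupp.single e' 1) with ht
    have h0t : conn n m0 ≤ t := conn_mono le_self_add
    have het : t e'.1.1 e'.1.2 := conn_edge e' (by simp)
    have hsplit : conn n (m0 + Finsupp.single e 1) e'.1.1 e'.1.2 := by rw [hm]; exact he's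
    rcases conn_add_single m0 e _ _ hsplit with h | ⟨h1, h2⟩ | ⟨h1, h2⟩
    · exact (he'n h).elim
    · refine ⟨e', Quotient.sound (s.symm (hle h1)), hlt, le_antisymm hle' (hge ?_), ?_⟩
      · exact t.trans (h0t h1) (t.trans het (t.symm (h0t h2)))
      · refine move_cross k n m0 _ _ _ _ e.2.ne e'.2.ne ?_ h1 h2
        intro h
        exact he'n (h ▸ h2)
    · refine ⟨e', Quotient.sound (s.trans he's (s.symm (hle h2))), hlt,
        le_antisymm hle' (hge ?_), ?_⟩
      · exact t.trans (h0t h2) (t.trans (t.symm het) (t.symm (h0t h1)))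
      · rw [aa_symm k n e.1.1 e.1.2]
        refine move_cross k n m0 _ _ _ _ e.2.ne' e'.2.ne ?_ h1 h2
        intro h
        exact he'n (h ▸ h2)

theorem mon_eq (n : ℕ) (s : Setoid (Fin n)) (m m' : DIdx n →₀ ℕ) (hm : conn n m = s)
    (hm' : conn n m' = s) (h : Finsupp.mapDomain (blk s) m = Finsupp.mapDomain (blk s) m') :
    mon k n m = mon k n m' :=
  mon_eq_aux k n s m' hm' _ m rfl hm h

open Classical in
/-- The point of `D_n` (generic over its component) attached to a set partition. -/
def phi (n : ℕ) (s : Setoid (Fin n)) :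
    MvPolynomial (DIdx n) k →ₐ[k] MvPolynomial (Quotient s) k :=
  MvPolynomial.aeval fun e => if s e.1.1 e.1.2 then MvPolynomial.X (blk s e) else 0

open Classical in
theorem phi_Agen (n : ℕ) (s : Setoid (Fin n)) (i j : Fin n) (hij : i ≠ j) :
    phi k n s (Agen k n i j) = if s i j then MvPolynomial.X (Quotient.mk s i) else 0 := by
  unfold phi Agen
  rcases lt_or_gt_of_ne hij with h | h
  · rw [dif_pos h, MvPolynomial.aeval_X]
    rfl
  · rw [dif_neg h.not_gt, dif_pos h, MvPolynomial.aeval_X]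
    by_cases hs : s i j
    · have hs' := s.symm hs
      rw [if_pos hs, if_pos hs']
      congr 1
      exact Quotient.sound hs'
    · rw [if_neg hs, if_neg fun h' => hs (s.symm h')]

theorem phi_ideal (n : ℕ) (s : Setoid (Fin n)) (p : MvPolynomial (DIdx n) k)
    (hp : p ∈ Ideal.span (DRelSet k n)) : phi k n s p = 0 := by
  classical
  have : Ideal.span (DRelSet k n) ≤ RingHom.ker (phi k n s) := by
    rw [Ideal.span_le]
    rintro _ ⟨i, j, l, hij, hjl, hil, rfl⟩
    change phi k n s _ = 0
    rw [map_sub, map_mul, map_mul, phi_Agen k n s i j hij, phi_Agen k n s j l hjl,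
      phi_Agen k n s i l hil]
    by_cases h1 : s i j
    · have e1 : Quotient.mk s i = Quotient.mk s j := Quotient.sound h1
      by_cases h2 : s j l
      · have h3 := s.trans h1 h2
        simp [h1, h2, h3, e1]
      · have h3 : ¬ s i l := fun h => h2 (s.trans (s.symm h1) h)
        simp [h2, h3]
    · simp [h1]
  exact this hp

open Classical in
theorem phi_monomial (n : ℕ) (s : Setoid (Fin n)) (m : DIdx n →₀ ℕ) (c : k) :
    phi k n s (MvPolynomial.monomial m c) =
      if conn n m ≤ s then MvPolynomial.monomial (Finsupp.mapDomain (blk s) m) c else 0 := by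
  unfold phi
  rw [MvPolynomial.aeval_monomial]
  split_ifs with h
  · rw [conn_le_iff] at h
    rw [MvPolynomial.monomial_eq, MvPolynomial.algebraMap_eq,
      Finsupp.prod_mapDomain_index (fun _ => pow_zero _) (fun _ _ _ => pow_add _ _ _)]
    congr 1
    refine Finsupp.prod_congr fun e he => ?_
    rw [if_pos (h e (Finsupp.mem_support_iff.1 he))]
  · rw [conn_le_iff] at h
    push Not at h
    obtain ⟨e, he, hs⟩ := h
    rw [Finsupp.prod, Finset.prod_eq_zero (Finsupp.mem_support_iff.2 he), mul_zero]
    rw [if_neg hs, zero_pow he]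

theorem sum_group {ι τ V : Type} [AddCommGroup V] [Module k V] (S : Finset ι)
    (g : ι → (τ →₀ ℕ)) (c : ι → k) (u : ι → V)
    (hu : ∀ a ∈ S, ∀ b ∈ S, g a = g b → u a = u b)
    (h : ∑ a ∈ S, MvPolynomial.monomial (g a) (c a) = 0) : ∑ a ∈ S, c a • u a = 0 := by
  classical
  rw [← Finset.sum_fiberwise_of_maps_to (g := g) (t := S.image g)
    (fun a ha => Finset.mem_image_of_mem g ha)]
  refine Finset.sum_eq_zero fun b hb => ?_
  obtain ⟨a0, ha0, rfl⟩ := Finset.mem_image.1 hb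
  have h1 : ∑ a ∈ S with g a = g a0, c a = 0 := by
    have := congrArg (MvPolynomial.coeff (g a0)) h
    rw [MvPolynomial.coeff_sum] at this
    simpa [MvPolynomial.coeff_monomial, Finset.sum_filter] using this
  calc ∑ a ∈ S with g a = g a0, c a • u a = ∑ a ∈ S with g a = g a0, c a • u a0 := by
        refine Finset.sum_congr rfl fun a ha => ?_
        rw [Finset.mem_filter] at ha
        rw [hu a ha.1 a0 ha0 ha.2]
    _ = 0 := by rw [← Finset.sum_smul, h1, zero_smul]

open Classical in
/-- The part of a polynomial supported on monomials with given vertex partition. -/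
def part (n : ℕ) (p : MvPolynomial (DIdx n) k) (s : Setoid (Fin n)) : MvPolynomial (DIdx n) k :=
  ∑ m ∈ p.support with conn n m = s, MvPolynomial.monomial m (MvPolynomial.coeff m p)

open Classical in
theorem sum_part (n : ℕ) (p : MvPolynomial (DIdx n) k) :
    ∑ s ∈ p.support.image (conn n), part k n p s = p := by
  unfold part
  have h := Finset.sum_fiberwise_of_maps_to (s := p.support) (t := p.support.image (conn n))
    (g := conn n) (fun a ha => Finset.mem_image_of_mem _ ha)
    (fun m => MvPolynomial.monomial m (MvPolynomial.coeff m p))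
  rw [← MvPolynomial.as_sum p] at h
  convert h

theorem part_mem (n : ℕ) (p : MvPolynomial (DIdx n) k) (hp : ∀ s, phi k n s p = 0)
    (s : Setoid (Fin n)) : part k n p s ∈ Ideal.span (DRelSet k n) := by
  classical
  have hfin : Finite (Setoid (Fin n)) :=
    Finite.of_injective (fun s : Setoid (Fin n) => (fun i j => s i j))
      (fun a b h => Setoid.ext fun i j => iff_of_eq (congrFun (congrFun h i) j))
  induction s using WellFoundedLT.induction with
  | _ s ih =>
  have h1 : phi k n s (part k n p s) = 0 := by
    rw [← hp s]
    conv_rhs => rw [← sum_part k n p]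
    rw [map_sum]
    symm
    refine Finset.sum_eq_single s (fun t _ hts => ?_) (fun hs => ?_)
    · by_cases hle : t ≤ s
      · exact phi_ideal k n s _ (ih t (lt_of_le_of_ne hle hts))
      · unfold part
        rw [map_sum]
        refine Finset.sum_eq_zero fun m hm => ?_
        rw [phi_monomial, if_neg]
        rw [(Finset.mem_filter.1 hm).2]
        exact hle
    · unfold part
      rw [Finset.filter_eq_empty_iff.2, Finset.sum_empty, map_zero]
      intro m hm hms
      exact hs (Finset.mem_image.2 ⟨m, hm, hms⟩)
  rw [← Ideal.Quotient.eq_zero_iff_mem]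
  unfold part at h1 ⊢
  rw [map_sum] at h1 ⊢
  have h2 := sum_group k (V := DAlg k n) (p.support.filter fun m => conn n m = s)
    (fun m => Finsupp.mapDomain (blk s) m) (fun m => MvPolynomial.coeff m p) (mon k n)
    (fun a ha b hb hab => mon_eq k n s a b (Finset.mem_filter.1 ha).2 (Finset.mem_filter.1 hb).2 hab)
    (by
      rw [← h1]
      refine Finset.sum_congr rfl fun m hm => ?_
      rw [phi_monomial, if_pos (Finset.mem_filter.1 hm).2.le])
  rw [← h2]
  refine Finset.sum_congr rfl fun m _ => ?_
  unfold mon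
  rw [← Ideal.Quotient.mkₐ_eq_mk k, ← map_smul, MvPolynomial.smul_monomial, smul_eq_mul, mul_one]

theorem mem_of_phi (n : ℕ) (p : MvPolynomial (DIdx n) k) (hp : ∀ s, phi k n s p = 0) :
    p ∈ Ideal.span (DRelSet k n) := by
  classical
  rw [← sum_part k n p]
  exact Ideal.sum_mem _ fun s _ => part_mem k n p hp s

theorem DAlg_red (n : ℕ) : IsReduced (DAlg k n) := by
  refine ⟨fun x hx => ?_⟩
  obtain ⟨p, rfl⟩ := Ideal.Quotient.mk_surjective x
  obtain ⟨N, hN⟩ := hx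
  rw [← map_pow, Ideal.Quotient.eq_zero_iff_mem] at hN
  rw [Ideal.Quotient.eq_zero_iff_mem]
  refine mem_of_phi k n p fun s => ?_
  have := phi_ideal k n s _ hN
  rw [map_pow] at this
  exact eq_zero_of_pow_eq_zero this

set_option synthInstance.maxHeartbeats 1000000 in
/-- the algebra `D_n` is reduced (no nonzero nilpotents);
consequently it is semiprime (no nonzero ideal squares to zero). -/
theorem DAlg_isReduced (n : ℕ) (hn : 2 ≤ n) :
    IsReduced (DAlg k n) ∧ ∀ I : Ideal (DAlg k n), I * I = ⊥ → I = ⊥ := by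
  haveI := DAlg_red k n
  refine ⟨this, fun I hI => ?_⟩
  rw [eq_bot_iff]
  intro x hx
  have h : x * x ∈ I * I := Ideal.mul_mem_mul hx hx
  rw [hI, Ideal.mem_bot] at h
  rw [Ideal.mem_bot]
  exact IsReduced.eq_zero x ⟨2, by rw [pow_two]; exact h⟩

end
end
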